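/- Let G be a finite simple graph, k a positive integer, and e = xy an edge of G. Then γ_{P,k}(G/e) ≥ γ_{P,k}(G) − 1, where G/e is the graph obtained from G by deleting x and y and adding a new vertex v_{xy} adjacent to every vertex of (N_G(x) ∪ N_G(y)) \ {x, y}. -/

import Mathlib

open SimpleGraph

variable {V : Type*}

/-- The closed neighbourhood `N_G[v]` of a vertex. -/
def closedNbhd (G : SimpleGraph V) (v : V) : Set V := insert v (G.neighborSet v)

/-- The closed neighbourhood `N_G[X]` of a set of vertices. -/
def closedNbhdSet (G : SimpleGraph V) (X : Set V) : Set V := ⋃ v ∈ X, closedNbhd G v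

/-- The sets `P^i_{G,k}(S)` of vertices monitored by `S` at step `i`. -/
def monitored (G : SimpleGraph V) (k : ℕ) (S : Set V) : ℕ → Set V
  | 0 => closedNbhdSet G S
  | i + 1 =>
      ⋃ v ∈ {w | w ∈ monitored G k S i ∧ (closedNbhd G w \ monitored G k S i).ncard ≤ k},
        closedNbhd G v

/-- `S` is a `k`-power dominating set of `G`. -/
def IsPDS (G : SimpleGraph V) (k : ℕ) (S : Set V) : Prop :=
  ∃ i, monitored G k S i = Set.univ

/-- The `k`-power domination number `γ_{P,k}(G)`. -/
noncomputable def pdn (G : SimpleGraph V) (k : ℕ) : ℕ :=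
  sInf {n | ∃ S : Set V, IsPDS G k S ∧ S.ncard = n}

/-- The radius `rad_{P,k}(G,S)` of a `k`-PDS `S`. -/
noncomputable def radPDS (G : SimpleGraph V) (k : ℕ) (S : Set V) : ℕ :=
  1 + sInf {i | monitored G k S i = Set.univ}

/-- The `k`-propagation radius `rad_{P,k}(G)`. -/
noncomputable def propRad (G : SimpleGraph V) (k : ℕ) : ℕ :=
  sInf {r | ∃ S : Set V, IsPDS G k S ∧ S.ncard = pdn G k ∧ radPDS G k S = r}

/-- The contraction `G/e` of the edge `e = xy`: delete `x` and `y` and replace them by a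
new vertex (represented by `x`) adjacent to all vertices in `(N_G(x) ∪ N_G(y)) \ {x, y}`. -/
def contractEdge (G : SimpleGraph V) (x y : V) : SimpleGraph {u : V // u ≠ y} :=
  SimpleGraph.fromRel (fun a b =>
    ((a : V) = x ∧ (G.Adj x b ∨ G.Adj y b)) ∨ ((a : V) ≠ x ∧ (b : V) ≠ x ∧ G.Adj a b))

theorem mem_closedNbhd {V : Type*} {G : SimpleGraph V} {v w : V} :
    w ∈ closedNbhd G v ↔ w = v ∨ G.Adj v w := by
  simp [closedNbhd]

theorem closedNbhd_subset_monitored_zero {V : Type*} {G : SimpleGraph V} {k : ℕ} {S : Set V}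
    {v : V} (hv : v ∈ S) : closedNbhd G v ⊆ monitored G k S 0 :=
  Set.subset_biUnion_of_mem (u := closedNbhd G) hv

theorem closedNbhd_subset_monitored_succ {V : Type*} {G : SimpleGraph V} {k i : ℕ} {S : Set V}
    {v : V} (hv : v ∈ monitored G k S i)
    (hk : (closedNbhd G v \ monitored G k S i).ncard ≤ k) :
    closedNbhd G v ⊆ monitored G k S (i + 1) :=
  Set.subset_biUnion_of_mem (u := closedNbhd G)
    (s := {w | w ∈ monitored G k S i ∧ (closedNbhd G w \ monitored G k S i).ncard ≤ k}) ⟨hv, hk⟩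

theorem closedNbhd_subset_monitored {V : Type*} {G : SimpleGraph V} (k : ℕ) {S : Set V}
    {v : V} (hv : v ∈ S) (i : ℕ) : closedNbhd G v ⊆ monitored G k S i := by
  induction i with
  | zero => exact closedNbhd_subset_monitored_zero hv
  | succ i ih =>
    refine closedNbhd_subset_monitored_succ (ih (mem_closedNbhd.2 (Or.inl rfl))) ?_
    simp [Set.sdiff_eq_empty.2 ih]

theorem isPDS_univ {V : Type*} (G : SimpleGraph V) (k : ℕ) : IsPDS G k Set.univ :=
  ⟨0, Set.eq_univ_of_forall fun v =>
    closedNbhd_subset_monitored_zero (Set.mem_univ v) (mem_closedNbhd.2 (Or.inl rfl))⟩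

theorem exists_isPDS_ncard_eq_pdn {V : Type*} (G : SimpleGraph V) (k : ℕ) :
    ∃ S : Set V, IsPDS G k S ∧ S.ncard = pdn G k :=
  Nat.sInf_mem (s := {n | ∃ S : Set V, IsPDS G k S ∧ S.ncard = n})
    ⟨_, Set.univ, isPDS_univ G k, rfl⟩

theorem pdn_le_ncard {V : Type*} {G : SimpleGraph V} {k : ℕ} {S : Set V} (hS : IsPDS G k S) :
    pdn G k ≤ S.ncard :=
  Nat.sInf_le ⟨S, hS, rfl⟩

/-- Away from `x`, closed neighbourhoods of the contraction are inherited from `G`. -/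
theorem mem_closedNbhd_contractEdge {V : Type*} {G : SimpleGraph V} {x y : V}
    {w u : {u : V // u ≠ y}} (hw : (w : V) ≠ x) (hu : (u : V) ≠ x) :
    u ∈ closedNbhd (contractEdge G x y) w ↔ (u : V) ∈ closedNbhd G w := by
  have := @SimpleGraph.Adj.ne _ G w u
  simp only [mem_closedNbhd, contractEdge, fromRel_adj, Subtype.ext_iff, ne_eq, G.adj_comm u w]
  grind

/-- The closed neighbourhood of the contracted vertex. -/
theorem mem_closedNbhd_contractEdge_self {V : Type*} {G : SimpleGraph V} {x y : V}
    {w u : {u : V // u ≠ y}} (hw : (w : V) = x) (hu : (u : V) ≠ x) :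
    u ∈ closedNbhd (contractEdge G x y) w ↔
      (u : V) ∈ closedNbhd G x ∨ (u : V) ∈ closedNbhd G y := by
  have := u.2
  simp only [mem_closedNbhd, contractEdge, fromRel_adj, Subtype.ext_iff, ne_eq]
  grind

theorem ncard_closedNbhd_sdiff_le_contractEdge {V : Type*} [Finite V] {G : SimpleGraph V}
    {x y : V} {P : Set V} {Q : Set {u : V // u ≠ y}} (hx : x ∈ P) (hy : y ∈ P)
    (hQ : ∀ u ∈ Q, (u : V) ∈ P) {g : V} {w : {u : V // u ≠ y}}
    (hg : ∀ u : {u : V // u ≠ y}, (u : V) ≠ x → (u : V) ∈ closedNbhd G g →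
      u ∈ closedNbhd (contractEdge G x y) w) :
    (closedNbhd G g \ P).ncard ≤ (closedNbhd (contractEdge G x y) w \ Q).ncard := by
  rw [← Set.ncard_image_of_injective _ Subtype.val_injective]
  refine Set.ncard_le_ncard ?_ (Set.toFinite _)
  rintro z ⟨hz, hzP⟩
  have hzx : z ≠ x := by rintro rfl; exact hzP hx
  have hzy : z ≠ y := by rintro rfl; exact hzP hy
  exact ⟨⟨z, hzy⟩, ⟨hg _ hzx hz, fun h => hzP (hQ _ h)⟩, rfl⟩

theorem mem_monitored_of_mem_monitored_contractEdge {V : Type*} [Finite V]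
    {G : SimpleGraph V} {k : ℕ} {x y : V} (hxy : G.Adj x y) {S : Set {u : V // u ≠ y}}
    {T : Set V} (hST : ∀ s ∈ S, (s : V) ∈ T) (hx : x ∈ T)
    (hy : (∃ s ∈ S, (s : V) = x) → y ∈ T) (i : ℕ) :
    ∀ u ∈ monitored (contractEdge G x y) k S i, (u : V) ∈ monitored G k T i := by
  have hN := closedNbhd_subset_monitored (G := G) k hx
  have hxP (i : ℕ) : x ∈ monitored G k T i := hN i (mem_closedNbhd.2 (Or.inl rfl))
  have hyP (i : ℕ) : y ∈ monitored G k T i := hN i (mem_closedNbhd.2 (Or.inr hxy))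
  induction i with
  | zero =>
    intro u hu
    obtain ⟨s, hs, hus⟩ := Set.mem_iUnion₂.1 hu
    by_cases hux : (u : V) = x
    · exact hux ▸ hxP 0
    by_cases hsx : (s : V) = x
    · rcases (mem_closedNbhd_contractEdge_self hsx hux).1 hus with h | h
      · exact hN 0 h
      · exact closedNbhd_subset_monitored_zero (hy ⟨s, hs, hsx⟩) h
    · exact closedNbhd_subset_monitored_zero (hST s hs)
        ((mem_closedNbhd_contractEdge hsx hux).1 hus)
  | succ i ih =>
    intro u hu
    obtain ⟨w, ⟨hw, hwk⟩, huw⟩ := Set.mem_iUnion₂.1 hu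
    by_cases hux : (u : V) = x
    · exact hux ▸ hxP (i + 1)
    by_cases hwx : (w : V) = x
    · rcases (mem_closedNbhd_contractEdge_self hwx hux).1 huw with h | h
      · exact hN (i + 1) h
      · refine closedNbhd_subset_monitored_succ (hyP i) (le_trans ?_ hwk) h
        exact ncard_closedNbhd_sdiff_le_contractEdge (hxP i) (hyP i) ih
          fun v hv hvy => (mem_closedNbhd_contractEdge_self hwx hv).2 (Or.inr hvy)
    · refine closedNbhd_subset_monitored_succ (ih w hw) (le_trans ?_ hwk)
        ((mem_closedNbhd_contractEdge hwx hux).1 huw)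
      exact ncard_closedNbhd_sdiff_le_contractEdge (hxP i) (hyP i) ih
        fun v hv hvw => (mem_closedNbhd_contractEdge hwx hv).2 hvw

theorem IsPDS.of_contractEdge {V : Type*} [Finite V] {G : SimpleGraph V} {k : ℕ} {x y : V}
    (hxy : G.Adj x y) {S : Set {u : V // u ≠ y}} (hS : IsPDS (contractEdge G x y) k S)
    {T : Set V} (hST : ∀ s ∈ S, (s : V) ∈ T) (hx : x ∈ T)
    (hy : (∃ s ∈ S, (s : V) = x) → y ∈ T) : IsPDS G k T := by
  obtain ⟨i, hi⟩ := hS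
  refine ⟨i, Set.eq_univ_of_forall fun v => ?_⟩
  by_cases hv : v = y
  · exact closedNbhd_subset_monitored k hx i (mem_closedNbhd.2 (Or.inr (hv ▸ hxy)))
  · exact mem_monitored_of_mem_monitored_contractEdge hxy hST hx hy i ⟨v, hv⟩
      (hi ▸ Set.mem_univ _)

theorem pdn_edge_contraction_lower {V : Type*} [Fintype V] [DecidableEq V]
    (G : SimpleGraph V) (k : ℕ) (hk : 0 < k) (x y : V) (hxy : G.Adj x y) :
    pdn G k ≤ pdn (contractEdge G x y) k + 1 := by
  obtain ⟨S, hS, hcard⟩ := exists_isPDS_ncard_eq_pdn (contractEdge G x y) k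
  rw [← hcard, ← Set.ncard_image_of_injective S Subtype.val_injective]
  have hsub (z : V) : ∀ s ∈ S, (s : V) ∈ insert z (Subtype.val '' S) :=
    fun s hs => Set.mem_insert_of_mem _ ⟨s, hs, rfl⟩
  by_cases hx : ∃ s ∈ S, (s : V) = x
  · exact (pdn_le_ncard (hS.of_contractEdge hxy (hsub y) (Set.mem_insert_of_mem _ hx)
      fun _ => Set.mem_insert _ _)).trans (Set.ncard_insert_le _ _)
  · exact (pdn_le_ncard (hS.of_contractEdge hxy (hsub x) (Set.mem_insert _ _)
      fun h => absurd h hx)).trans (Set.ncard_insert_le _ _)
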